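/- arXiv:math/0312198 — 9 statements merged into one kernel-verified Lean document; each statement's English description precedes it below -/
import Mathlib

section
/- Let n ≥ 1 be an integer and let α, β ∈ ℂ be such that none of α, β, α+β is a negative integer. Let T be the n×n Toeplitz matrix whose (i,j) entry (1 ≤ i,j ≤ n) is φ_{i-j}, where for k ∈ ℤ, φ_k = (-1)^k Γ(α+β+1) · (1/Γ(α+1-k)) · (1/Γ(β+1+k)). Then det T = ∏_{ℓ=1}^{n} [Γ(ℓ) Γ(α+β+ℓ)] / [Γ(α+ℓ) Γ(β+ℓ)]. -/
open Complex Finset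

open Polynomial in
/-- auxiliary polynomials -/
noncomputable def fhq (β : ℂ) (N : ℕ) (s : ℂ) (j : ℕ) : ℂ[X] :=
  (∏ k ∈ Finset.Ico j N, (X - C (s + k))) * ∏ k ∈ Finset.range j, (X - C ((k : ℂ) - β))

open Polynomial in
lemma fhq_monic (β : ℂ) (N : ℕ) (s : ℂ) (j : ℕ) : (fhq β N s j).Monic :=
  (monic_prod_of_monic _ _ fun _ _ => monic_X_sub_C _).mul
    (monic_prod_of_monic _ _ fun _ _ => monic_X_sub_C _)

open Polynomial in
lemma fhq_natDegree (β : ℂ) (N : ℕ) (s : ℂ) (j : ℕ) (hj : j ≤ N) :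
    (fhq β N s j).natDegree = N := by
  unfold fhq
  rw [Monic.natDegree_mul (monic_prod_of_monic _ _ fun _ _ => monic_X_sub_C _)
    (monic_prod_of_monic _ _ fun _ _ => monic_X_sub_C _),
    natDegree_prod_of_monic _ _ (fun _ _ => monic_X_sub_C _),
    natDegree_prod_of_monic _ _ (fun _ _ => monic_X_sub_C _)]
  simp only [natDegree_X_sub_C, Finset.sum_const, Nat.card_Ico, Finset.card_range, smul_eq_mul,
    mul_one]
  omega

open Polynomial in
lemma fhq_succ (β : ℂ) (N : ℕ) (s : ℂ) (j : ℕ) (hj : j ≤ N) :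
    fhq β (N+1) s (j+1) = C (s + β) * fhq β N (s+1) j + fhq β (N+1) s j := by
  unfold fhq
  rw [Finset.prod_range_succ, Finset.prod_eq_prod_Ico_succ_bot (show j < N + 1 by omega)]
  have : ∏ k ∈ Finset.Ico j N, (X - C (s + 1 + (k : ℂ)))
      = ∏ k ∈ Finset.Ico (j+1) (N+1), (X - C (s + (k : ℂ))) := by
    rw [← Finset.prod_Ico_add' (fun k : ℕ => (X - C (s + (k : ℂ)))) j N 1]
    refine Finset.prod_congr rfl fun k _ => ?_
    push_cast
    congr 2
    ring
  rw [this]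
  simp only [map_add, map_sub]
  ring

lemma fhq_det (β : ℂ) (N : ℕ) : ∀ s : ℂ,
    (Matrix.of fun i j : Fin (N+1) => (fhq β N s j).coeff i).det
      = ∏ i ∈ Finset.range (N+1), ∏ m ∈ Finset.range i, (-(s + β + m)) := by
  induction N with
  | zero => intro s; simp [fhq]
  | succ N ih =>
    intro s
    rw [Matrix.det_eq_of_forall_col_eq_smul_add_pred (B := Matrix.of fun i j : Fin (N+2) =>
      (Fin.cases ((fhq β (N+1) s 0).coeff i)
        (fun j : Fin (N+1) => (s + β) * (fhq β N (s+1) j).coeff i) j : ℂ)) (fun _ => 1)]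
    · rw [Matrix.det_succ_row _ (Fin.last (N+1)), Fin.sum_univ_succ]
      have h0 : (fhq β (N+1) s 0).coeff (N+1) = 1 := by
        have := fhq_monic β (N+1) s 0
        rw [Polynomial.Monic, Polynomial.leadingCoeff, fhq_natDegree _ _ _ _ (by omega)] at this
        exact this
      have h1 : ∀ j : Fin (N+1), (fhq β N (s+1) j).coeff (N+1) = 0 := fun j =>
        Polynomial.coeff_eq_zero_of_natDegree_lt (by
          rw [fhq_natDegree _ _ _ _ (by omega)]; omega)
      have h2 : ((Matrix.of fun i j : Fin (N+2) =>
      (Fin.cases ((fhq β (N+1) s 0).coeff i)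
        (fun j : Fin (N+1) => (s + β) * (fhq β N (s+1) j).coeff i) j : ℂ)).submatrix
          (Fin.last (N+1)).succAbove (Fin.succAbove 0))
          = (s + β) • (Matrix.of fun i j : Fin (N+1) => (fhq β N (s+1) j).coeff i) := by
        ext i j
        simp
      rw [h2, Matrix.det_smul, ih]
      simp only [Matrix.of_apply, Fin.cases_zero, Fin.cases_succ, Fin.val_last, h0, h1]
      have h3 : ∏ i ∈ Finset.range (N+1+1), ∏ m ∈ Finset.range i, (-(s + β + m))
          = (-(s + β)) ^ (N+1) *
            ∏ i ∈ Finset.range (N+1), ∏ m ∈ Finset.range i, (-(s + 1 + β + m)) := by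
        rw [Finset.prod_range_succ' _ (N+1), Finset.range_zero, Finset.prod_empty, mul_one]
        have : ∀ i ∈ Finset.range (N+1), ∏ m ∈ Finset.range (i+1), (-(s + β + (m : ℂ)))
            = (-(s + β)) * ∏ m ∈ Finset.range i, (-(s + 1 + β + (m : ℂ))) := by
          intro i _
          rw [Finset.prod_range_succ', mul_comm]
          congr 1
          · simp
          · refine Finset.prod_congr rfl fun m _ => ?_
            push_cast
            ring
        rw [Finset.prod_congr rfl this, Finset.prod_mul_distrib, Finset.prod_const,
          Finset.card_range]
      rw [h3, neg_pow (s + β)]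
      simp [mul_assoc]
    · intro i; simp
    · intro i j
      simp only [Matrix.of_apply, Fin.val_succ, fhq_succ β N s j (by omega),
        Polynomial.coeff_add, Polynomial.coeff_C_mul, Fin.cases_succ, Fin.val_castSucc, one_mul]

lemma fh_rGamma (z : ℂ) (m : ℕ) :
    (Complex.Gamma z)⁻¹ = (∏ k ∈ Finset.range m, (z + k)) * (Complex.Gamma (z + m))⁻¹ := by
  induction m with
  | zero => simp
  | succ m ih =>
    rw [ih, Finset.prod_range_succ, Complex.one_div_Gamma_eq_self_mul_one_div_Gamma_add_one (z + m)]
    push_cast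
    rw [add_assoc z]
    ring

lemma fh_Gamma (z : ℂ) (hz : ∀ m : ℕ, z ≠ -m) (m : ℕ) :
    Complex.Gamma (z + m) = Complex.Gamma z * (∏ k ∈ Finset.range m, (z + k)) := by
  have h := fh_rGamma z m
  have h1 := Complex.Gamma_ne_zero hz
  have h2 : Complex.Gamma (z + m) ≠ 0 := Complex.Gamma_ne_zero fun k hk => hz (k + m) (by
    push_cast; linear_combination hk)
  field_simp at h
  rw [h]

lemma fh_entry (α β : ℂ) (N i j : ℕ) (hi : i ≤ N) (hj : j ≤ N) :
    (-1 : ℂ) ^ ((i : ℤ) - j) * Complex.Gamma (α + β + 1) *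
      (Complex.Gamma (α + 1 - ((i : ℤ) - j : ℤ)))⁻¹ * (Complex.Gamma (β + 1 + ((i : ℤ) - j : ℤ)))⁻¹
    = ((-1) ^ (N - i) * Complex.Gamma (α + β + 1) * (Complex.Gamma (α + ((N - i : ℕ) + 1)))⁻¹ *
        (Complex.Gamma (β + (i + 1)))⁻¹) * (fhq β N (α + 1) j).eval (i : ℂ) := by
  rw [fh_rGamma (α + 1 - ((i : ℤ) - j : ℤ)) (N - j), fh_rGamma (β + 1 + ((i : ℤ) - j : ℤ)) j]
  have e1 : α + 1 - (((i : ℤ) - j : ℤ) : ℂ) + (N - j : ℕ) = α + ((N - i : ℕ) + 1) := by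
    push_cast [Nat.cast_sub hi, Nat.cast_sub hj]; ring
  have e2 : β + 1 + (((i : ℤ) - j : ℤ) : ℂ) + j = β + (i + 1) := by
    push_cast; ring
  rw [e1, e2]
  have e3 : (fhq β N (α + 1) j).eval (i : ℂ) =
      ((-1) ^ (N - j) * ∏ k ∈ Finset.range (N - j), (α + 1 - (((i : ℤ) - j : ℤ) : ℂ) + k)) *
      ∏ k ∈ Finset.range j, (β + 1 + (((i : ℤ) - j : ℤ) : ℂ) + k) := by
    unfold fhq
    rw [Polynomial.eval_mul, Polynomial.eval_prod, Polynomial.eval_prod,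
      Finset.prod_Ico_eq_prod_range]
    congr 1
    · rw [← Finset.card_range (N - j), ← Finset.prod_const, Finset.card_range,
        ← Finset.prod_mul_distrib]
      refine Finset.prod_congr rfl fun k _ => ?_
      simp
      ring
    · rw [← Finset.prod_range_reflect]
      refine Finset.prod_congr rfl fun k hk => ?_
      have hk : k + 1 ≤ j := by simpa using hk
      rw [Nat.sub_sub, add_comm 1 k]
      push_cast [Nat.cast_sub hk]
      simp [Nat.cast_sub hk]
      ring
  have e4 : (-1 : ℂ) ^ ((i : ℤ) - j) = (-1) ^ (N - i) * (-1) ^ (N - j) := by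
    rw [← pow_add, ← zpow_natCast, ← mul_one ((-1 : ℂ) ^ ((i : ℤ) - j))]
    have : ((N - i + (N - j) : ℕ) : ℤ) = ((i : ℤ) - j) + 2 * (N - i) := by omega
    rw [this, zpow_add₀ (by norm_num), zpow_mul]
    norm_num
  rw [e3, e4]
  ring

/-- The pure Fisher–Hartwig determinant formula:
for `φ_k = (-1)^k Γ(α+β+1) / (Γ(α+1-k) Γ(β+1+k))`, the Toeplitz determinant
`det (φ_{i-j})` equals `∏_{ℓ=1}^n Γ(ℓ)Γ(α+β+ℓ)/(Γ(α+ℓ)Γ(β+ℓ))`. -/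
theorem fisher_hartwig_determinant (n : ℕ) (hn : 1 ≤ n) (α β : ℂ)
    (hα : ∀ m : ℕ, α ≠ -(m + 1 : ℕ)) (hβ : ∀ m : ℕ, β ≠ -(m + 1 : ℕ))
    (hαβ : ∀ m : ℕ, α + β ≠ -(m + 1 : ℕ))
    (φ : ℤ → ℂ)
    (hφ : ∀ k : ℤ, φ k = (-1 : ℂ) ^ k * Complex.Gamma (α + β + 1) *
      (Complex.Gamma (α + 1 - k))⁻¹ * (Complex.Gamma (β + 1 + k))⁻¹)
    (T : Matrix (Fin n) (Fin n) ℂ)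
    (hT : ∀ i j : Fin n, T i j = φ ((i : ℤ) - (j : ℤ))) :
    T.det = ∏ ℓ ∈ Finset.range n,
      (Complex.Gamma (ℓ + 1) * Complex.Gamma (α + β + (ℓ + 1))) /
        (Complex.Gamma (α + (ℓ + 1)) * Complex.Gamma (β + (ℓ + 1))) := by
  obtain ⟨N, rfl⟩ : ∃ N, n = N + 1 := ⟨n - 1, by omega⟩
  let v : ℕ → ℂ := fun i => (-1) ^ (N - i) * Complex.Gamma (α + β + 1) *
    (Complex.Gamma (α + ((N - i : ℕ) + 1)))⁻¹ * (Complex.Gamma (β + (i + 1)))⁻¹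
  have hTv : T = Matrix.of fun i j : Fin (N+1) => v i *
      (Matrix.of fun i j : Fin (N+1) => (fhq β N (α + 1) j).eval ((i : ℕ) : ℂ)) i j := by
    ext i j
    rw [hT, hφ, fh_entry α β N i j (by omega) (by omega)]
    simp [v]
  have hV : (Matrix.of fun i j : Fin (N+1) => (fhq β N (α + 1) j).eval ((i : ℕ) : ℂ))
      = Matrix.vandermonde (fun i : Fin (N+1) => ((i : ℕ) : ℂ)) *
        (Matrix.of fun i j : Fin (N+1) => (fhq β N (α + 1) j).coeff i) := by
    ext i j
    rw [Matrix.mul_apply, Matrix.of_apply, Polynomial.eval_eq_sum_range' (n := N + 1) (by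
      rw [fhq_natDegree _ _ _ _ (by omega)]; omega), Finset.sum_range]
    refine Finset.sum_congr rfl fun k _ => ?_
    rw [Matrix.vandermonde_apply, Matrix.of_apply, mul_comm]
  have hS : (Matrix.vandermonde (fun i : Fin (N+1) => ((i : ℕ) : ℂ))).det
      = ∏ l ∈ Finset.range (N+1), Complex.Gamma (l + 1) := by
    rw [Matrix.det_vandermonde_id_eq_superFactorial]
    clear hV hTv v hT T hn
    induction N with
    | zero => simp
    | succ N ih =>
      rw [Finset.prod_range_succ, ← ih, Nat.superFactorial, Complex.Gamma_nat_eq_factorial]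
      push_cast
      ring
  rw [hTv, Matrix.det_mul_column, hV, Matrix.det_mul, fhq_det, hS,
    Fin.prod_univ_eq_prod_range v (N+1)]
  have hv : ∏ i ∈ Finset.range (N+1), v i = ∏ i ∈ Finset.range (N+1), ((-1) ^ i *
      Complex.Gamma (α + β + 1) *
      (Complex.Gamma (α + (i + 1)))⁻¹ * (Complex.Gamma (β + (i + 1)))⁻¹) := by
    simp only [v, Finset.prod_mul_distrib]
    congr 1
    congr 1
    · congr 1
      exact Finset.prod_range_reflect (fun i => (-1 : ℂ) ^ i) (N+1)
    · exact Finset.prod_range_reflect (fun i => (Complex.Gamma (α + ((i : ℕ) + 1)))⁻¹) (N+1)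
  rw [hv, ← Finset.prod_mul_distrib, ← Finset.prod_mul_distrib]
  refine Finset.prod_congr rfl fun l _ => ?_
  have hg := fh_Gamma (α + β + 1) (fun m hm => hαβ m (by push_cast; linear_combination hm)) l
  rw [show α + β + ((l : ℂ) + 1) = α + β + 1 + l by ring, hg]
  have : ∏ m ∈ Finset.range l, (-(α + 1 + β + (m : ℂ)))
      = (-1) ^ l * ∏ m ∈ Finset.range l, (α + β + 1 + (m : ℂ)) := by
    rw [← Finset.card_range l, ← Finset.prod_const, Finset.card_range, ← Finset.prod_mul_distrib]
    exact Finset.prod_congr rfl fun k _ => by ring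
  rw [this, div_eq_mul_inv, mul_inv]
  have h1 : ((-1 : ℂ) ^ l) * (-1) ^ l = 1 := by rw [← mul_pow]; simp
  linear_combination (Complex.Gamma (l + 1) * Complex.Gamma (α + β + 1) *
    (∏ m ∈ Finset.range l, (α + β + 1 + (m : ℂ))) *
    (Complex.Gamma (α + (l + 1)))⁻¹ * (Complex.Gamma (β + (l + 1)))⁻¹) * h1
end

section
/- Let n ≥ 1 be an integer and let α, β ∈ ℂ be arbitrary. Then the determinant of the n×n matrix with (i,j) entry (1 ≤ i,j ≤ n) equal to (-1)^{i-j} · (1/Γ(α+1-i+j)) · (1/Γ(β+1+i-j)) equals [∏_{k=1}^{n-1} (n-k)! · (α+β+k)^{n-k}] · ∏_{ℓ=1}^{n} (1/Γ(α+ℓ)) · (1/Γ(β+ℓ)). This identity holds for all complex α, β with no exceptional values. -/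
open Complex Finset

namespace FHAux

open Polynomial in
noncomputable def Q (m : ℕ) (α β : ℂ) (j : ℕ) : ℂ[X] :=
  (∏ s ∈ Finset.range j, (X - C ((s : ℂ) - β))) * ∏ t ∈ Finset.Ico j m, (X - C (α + 1 + t))

lemma Q_monic (m : ℕ) (α β : ℂ) (j : ℕ) : (Q m α β j).Monic :=
  (Polynomial.monic_prod_X_sub_C _ _).mul (Polynomial.monic_prod_X_sub_C _ _)

lemma Q_natDegree (m : ℕ) (α β : ℂ) (j : ℕ) (h : j ≤ m) : (Q m α β j).natDegree = m := by
  unfold Q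
  rw [(Polynomial.monic_prod_X_sub_C _ _).natDegree_mul (Polynomial.monic_prod_X_sub_C _ _),
    Polynomial.natDegree_prod_of_monic _ _ (fun i _ => Polynomial.monic_X_sub_C _),
    Polynomial.natDegree_prod_of_monic _ _ (fun i _ => Polynomial.monic_X_sub_C _)]
  simp only [Polynomial.natDegree_X_sub_C, Finset.sum_const, Finset.card_range, Nat.card_Ico,
    smul_eq_mul]
  omega

open Polynomial in
lemma Q_succ (m : ℕ) (α β : ℂ) (j : ℕ) (h : j ≤ m) :
    Q (m + 1) α β (j + 1) = C (α + β + 1) * Q m (α + 1) β j + Q (m + 1) α β j := by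
  have h1 : ∏ t ∈ Finset.Ico j m, (X - C (α + 1 + 1 + (t : ℂ))) =
      ∏ t ∈ Finset.Ico (j + 1) (m + 1), (X - C (α + 1 + (t : ℂ))) := by
    rw [← Finset.prod_Ico_add' (fun t : ℕ => (X - C (α + 1 + (t : ℂ)))) j m 1]
    refine Finset.prod_congr rfl fun t _ => ?_
    push_cast
    congr 2
    ring
  unfold Q
  rw [h1, Finset.prod_range_succ,
    Finset.prod_eq_prod_Ico_succ_bot (show j < m + 1 by omega)
      (fun t : ℕ => (X - C (α + 1 + (t : ℂ))))]
  simp only [C_add, C_sub]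
  ring

lemma det_coeff (m : ℕ) : ∀ (α β : ℂ),
    Matrix.det (Matrix.of fun i j : Fin (m + 1) => (Q m α β j).coeff i) =
      ∏ k ∈ Finset.range m, (-(α + β + (k + 1))) ^ (m - k) := by
  induction m with
  | zero =>
    intro α β
    simp [Q]
  | succ m ih =>
    intro α β
    rw [Matrix.det_eq_of_forall_col_eq_smul_add_pred
      (B := Matrix.of fun i j : Fin (m + 1 + 1) =>
        Fin.cases ((Q (m + 1) α β 0).coeff i)
          (fun j' : Fin (m + 1) => (α + β + 1) * (Q m (α + 1) β j').coeff i) j)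
      (fun _ => 1) (fun i => by simp) (fun i j => by
        have := Q_succ m α β j (by omega)
        simp [this, -Polynomial.C_add, -map_add, Polynomial.coeff_C_mul])]
    rw [Matrix.det_succ_row _ (Fin.last _), Fin.sum_univ_succ, Finset.sum_eq_zero]
    · have h0 : (Q (m + 1) α β 0).coeff (m + 1) = 1 := by
        have := (Q_monic (m + 1) α β 0).coeff_natDegree
        rwa [Q_natDegree _ _ _ _ (by omega)] at this
      have h2 : (Matrix.of fun i j : Fin (m + 1 + 1) =>
        (Fin.cases ((Q (m + 1) α β 0).coeff i)
          (fun j' : Fin (m + 1) => (α + β + 1) * (Q m (α + 1) β j').coeff i) j : ℂ)).submatrix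
          (Fin.last _).succAbove (Fin.succAbove 0) =
          (α + β + 1) • Matrix.of fun i j : Fin (m + 1) => (Q m (α + 1) β j).coeff i := by
        ext i j
        simp
      rw [h2, Matrix.det_smul, ih, Finset.prod_range_succ']
      simp only [Matrix.of_apply, Fin.cases_zero, Fin.val_last, h0, Fintype.card_fin]
      have h3 : ∀ k ∈ Finset.range m, (-(α + β + (((k + 1 : ℕ) : ℂ) + 1))) ^ (m + 1 - (k + 1))
          = (-(α + 1 + β + ((k : ℂ) + 1))) ^ (m - k) := by
        intro k _
        rw [Nat.add_sub_add_right]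
        push_cast
        ring
      rw [Finset.prod_congr rfl h3]
      simp only [Fin.val_zero, Nat.cast_zero, zero_add, add_zero, Nat.sub_zero, mul_one]
      rw [neg_pow (α + β + 1) (m + 1)]
      ring
    · intro j _
      have : (Q m (α + 1) β j).coeff (m + 1) = 0 := by
        apply Polynomial.coeff_eq_zero_of_natDegree_lt
        rw [Q_natDegree _ _ _ _ (by omega)]
        omega
      simp [this]

lemma gamma_shift (k : ℕ) (z : ℂ) :
    (Complex.Gamma z)⁻¹ = (∏ s ∈ Finset.range k, (z + s)) * (Complex.Gamma (z + k))⁻¹ := by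
  induction k with
  | zero => simp
  | succ k ih =>
    rw [ih, Complex.one_div_Gamma_eq_self_mul_one_div_Gamma_add_one (z + k),
      Finset.prod_range_succ]
    push_cast
    rw [add_assoc z]
    ring

lemma eval_det (m : ℕ) (α β : ℂ) :
    Matrix.det (Matrix.of fun i j : Fin (m + 1) => (Q m α β j).eval ((i : ℕ) : ℂ)) =
      (m.superFactorial : ℂ) * ∏ k ∈ Finset.range m, (-(α + β + (k + 1))) ^ (m - k) := by
  rw [← det_coeff, ← Matrix.det_vandermonde_id_eq_superFactorial, ← Matrix.det_mul]
  congr 1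
  ext i j
  rw [Matrix.mul_apply, Matrix.of_apply,
    Polynomial.eval_eq_sum_range' (n := m + 1) (by rw [Q_natDegree _ _ _ _ (by omega)]; omega),
    Finset.sum_range]
  refine Finset.sum_congr rfl fun k _ => ?_
  simp [Matrix.vandermonde_apply, mul_comm]

lemma entry (m i j : ℕ) (hi : i ≤ m) (hj : j ≤ m) (α β : ℂ) :
    (-1 : ℂ) ^ ((i : ℤ) - (j : ℤ)) *
          (Complex.Gamma (α + 1 - i + j))⁻¹ *
          (Complex.Gamma (β + 1 + i - j))⁻¹ =
    ((-1 : ℂ) ^ (m - i) * ((Complex.Gamma (α + ((m - i : ℕ) + 1)))⁻¹ *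
      (Complex.Gamma (β + (i + 1)))⁻¹)) * (Q m α β j).eval (i : ℂ) := by
  obtain ⟨p, rfl⟩ := Nat.exists_eq_add_of_le hi
  obtain ⟨q, hq⟩ := Nat.exists_eq_add_of_le hj
  have hq' : (i : ℂ) + p = j + q := by exact_mod_cast hq
  rw [gamma_shift q (α + 1 - i + j), gamma_shift j (β + 1 + i - j)]
  have e1 : α + 1 - i + j + q = α + ((i + p - i : ℕ) + 1) := by
    rw [Nat.add_sub_cancel_left]
    linear_combination -hq'
  have e2 : β + 1 + i - j + j = β + (i + 1) := by ring
  rw [e1, e2]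
  have e3 : (-1 : ℂ) ^ ((i : ℤ) - (j : ℤ)) = (-1) ^ p * (-1) ^ q := by
    have : (i : ℤ) - j = q - p := by omega
    rw [this, zpow_sub₀ (by norm_num), zpow_natCast, zpow_natCast, div_eq_iff (by simp)]
    have : ((-1 : ℂ) ^ p) * (-1) ^ p = 1 := by rw [← mul_pow]; simp
    linear_combination -(-1 : ℂ) ^ q * this
  have e4 : ∏ s ∈ Finset.range j, (β + 1 + i - j + (s : ℂ)) =
      ∏ s ∈ Finset.range j, ((i : ℂ) - ((s : ℂ) - β)) := by
    rw [← Finset.prod_range_reflect]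
    refine Finset.prod_congr rfl fun s hs => ?_
    have : s + 1 ≤ j := Finset.mem_range.1 hs
    rw [Nat.sub_sub, Nat.cast_sub (by omega)]
    push_cast
    ring
  have e5 : ∏ t ∈ Finset.Ico j (i + p), ((i : ℂ) - (α + 1 + t)) =
      (-1) ^ q * ∏ s ∈ Finset.range q, (α + 1 - i + j + (s : ℂ)) := by
    rw [Finset.prod_Ico_eq_prod_range, show i + p - j = q by omega]
    have : (-1 : ℂ) ^ q = ∏ s ∈ Finset.range q, (-1 : ℂ) := by simp
    rw [this, ← Finset.prod_mul_distrib]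
    refine Finset.prod_congr rfl fun s hs => ?_
    push_cast
    ring
  have e6 : (Q (i + p) α β j).eval (i : ℂ) =
    (∏ s ∈ Finset.range j, ((i : ℂ) - ((s : ℂ) - β))) *
      ∏ t ∈ Finset.Ico j (i + p), ((i : ℂ) - (α + 1 + t)) := by
    simp only [Q, Polynomial.eval_mul, Polynomial.eval_prod, Polynomial.eval_sub,
      Polynomial.eval_X, Polynomial.eval_C]
  rw [e6, e5, e4, e3, Nat.add_sub_cancel_left]
  ring

lemma sf_eq (m : ℕ) : m.superFactorial = ∏ k ∈ Finset.range m, (m - k).factorial := by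
  induction m with
  | zero => simp
  | succ m ih =>
    rw [Nat.superFactorial_succ, Finset.prod_range_succ', ih, mul_comm]
    simp

end FHAux

/-- The pure Fisher–Hartwig determinant divided by `Γ(α+β+1)^n`, as an identity of
entire functions of `α` and `β`, valid with no exceptional values. -/
theorem fisher_hartwig_entire (n : ℕ) (hn : 1 ≤ n) (α β : ℂ) :
    (Matrix.det (fun i j : Fin n =>
        (-1 : ℂ) ^ ((i : ℤ) - (j : ℤ)) *
          (Complex.Gamma (α + 1 - (i : ℤ) + (j : ℤ)))⁻¹ *
          (Complex.Gamma (β + 1 + (i : ℤ) - (j : ℤ)))⁻¹)) =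
      (∏ k ∈ Finset.range (n - 1),
        ((n - (k + 1)).factorial : ℂ) * (α + β + (k + 1)) ^ (n - (k + 1))) *
      ∏ ℓ ∈ Finset.range n,
        (Complex.Gamma (α + (ℓ + 1)))⁻¹ * (Complex.Gamma (β + (ℓ + 1)))⁻¹ := by
  obtain ⟨m, rfl⟩ := Nat.exists_eq_add_of_le' hn
  have h1 : (fun i j : Fin (m + 1) =>
        (-1 : ℂ) ^ ((i : ℤ) - (j : ℤ)) *
          (Complex.Gamma (α + 1 - (i : ℤ) + (j : ℤ)))⁻¹ *
          (Complex.Gamma (β + 1 + (i : ℤ) - (j : ℤ)))⁻¹) =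
      Matrix.of fun i j : Fin (m + 1) =>
        ((-1 : ℂ) ^ (m - (i : ℕ)) * ((Complex.Gamma (α + ((m - (i : ℕ) : ℕ) + 1)))⁻¹ *
          (Complex.Gamma (β + ((i : ℕ) + 1)))⁻¹)) *
        (Matrix.of fun i j : Fin (m + 1) => (FHAux.Q m α β j).eval ((i : ℕ) : ℂ)) i j := by
    funext i j
    have := FHAux.entry m i j (by omega) (by omega) α β
    simp only [Matrix.of_apply, Int.cast_natCast]
    exact this
  rw [h1, Matrix.det_mul_column (fun i : Fin (m + 1) =>
        ((-1 : ℂ) ^ (m - (i : ℕ)) * ((Complex.Gamma (α + ((m - (i : ℕ) : ℕ) + 1)))⁻¹ *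
          (Complex.Gamma (β + ((i : ℕ) + 1)))⁻¹))), FHAux.eval_det, FHAux.sf_eq,
    ← Finset.prod_range (fun i : ℕ =>
        ((-1 : ℂ) ^ (m - i) * ((Complex.Gamma (α + ((m - i : ℕ) + 1)))⁻¹ *
          (Complex.Gamma (β + (i + 1)))⁻¹)))]
  have h2 : ∏ i ∈ Finset.range (m + 1), (Complex.Gamma (α + ((m - i : ℕ) + 1)))⁻¹ =
      ∏ i ∈ Finset.range (m + 1), (Complex.Gamma (α + (i + 1)))⁻¹ := by
    rw [← Finset.prod_range_reflect (fun i : ℕ => (Complex.Gamma (α + ((i : ℂ) + 1)))⁻¹) (m + 1)]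
    simp
  have h3 : ∏ k ∈ Finset.range m, (-(α + β + ((k : ℂ) + 1))) ^ (m - k) =
      (∏ k ∈ Finset.range m, (-1 : ℂ) ^ (m - k)) *
        ∏ k ∈ Finset.range m, (α + β + ((k : ℂ) + 1)) ^ (m - k) := by
    rw [← Finset.prod_mul_distrib]
    exact Finset.prod_congr rfl fun k _ => neg_pow _ _
  have h4 : (∏ k ∈ Finset.range m, (-1 : ℂ) ^ (m - k)) *
      (∏ k ∈ Finset.range m, (-1 : ℂ) ^ (m - k)) = 1 := by
    rw [← Finset.prod_mul_distrib]
    refine Finset.prod_eq_one fun k _ => ?_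
    rw [← mul_pow]
    simp
  simp only [Finset.prod_mul_distrib, Nat.add_sub_cancel, Nat.add_sub_add_right, h2, h3]
  rw [Finset.prod_range_succ (fun i : ℕ => (-1 : ℂ) ^ (m - i)) m]
  simp only [Nat.sub_self, pow_zero, mul_one]
  push_cast
  generalize (∏ k ∈ Finset.range m, (-1 : ℂ) ^ (m - k)) = S at *
  generalize ∏ x ∈ Finset.range m, ((m - x).factorial : ℂ) = F
  generalize ∏ k ∈ Finset.range m, (α + β + ((k : ℂ) + 1)) ^ (m - k) = P at *
  generalize ∏ i ∈ Finset.range (m + 1), (Complex.Gamma (α + ((i : ℂ) + 1)))⁻¹ = A at *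
  generalize ∏ i ∈ Finset.range (m + 1), (Complex.Gamma (β + ((i : ℂ) + 1)))⁻¹ = B at *
  linear_combination (A * B * F * P) * h4
end

section
/- Let n ≥ 1 be an integer and let α, β ∈ ℂ be such that neither α nor β is a negative integer. Let M be the n×n matrix with (i,j) entry (1 ≤ i,j ≤ n) equal to Γ(α+1) Γ(β+1) · (1/Γ(α+1-i+j)) · (1/Γ(β+1+i-j)). Then det M = ∏_{k=1}^{n-1} [k · (α+β+k) / ((α+k)(β+k))]^{n-k}. -/
open Polynomial in
noncomputable def auxP (n : ℕ) (s : ℂ) (i : ℕ) : ℂ[X] :=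
  (∏ k ∈ Finset.range i, (X - C (k : ℂ))) *
    ∏ k ∈ Finset.range (n - i), (C (s + i + 1 + k) - X)

open Polynomial in
lemma auxP_add (n : ℕ) (s : ℂ) (i : ℕ) (hi : i ≤ n) :
    auxP (n + 1) s i + auxP (n + 1) s (i + 1) = C (s + 1) * auxP n (s + 1) i := by
  unfold auxP
  have e1 : n + 1 - i = (n - i) + 1 := by omega
  have e2 : n + 1 - (i + 1) = n - i := by omega
  rw [e1, e2, Finset.prod_range_succ', Finset.prod_range_succ _ i]
  have h1 : ∏ k ∈ Finset.range (n - i), (C (s + i + 1 + ((k + 1 : ℕ) : ℂ)) - X) =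
      ∏ k ∈ Finset.range (n - i), (C (s + 1 + i + 1 + (k : ℂ)) - X) := by
    refine Finset.prod_congr rfl fun k _ => ?_
    congr 2; push_cast; ring
  have h2 : ∏ k ∈ Finset.range (n - i), (C (s + ((i + 1 : ℕ) : ℂ) + 1 + (k : ℂ)) - X) =
      ∏ k ∈ Finset.range (n - i), (C (s + 1 + i + 1 + (k : ℂ)) - X) := by
    refine Finset.prod_congr rfl fun k _ => ?_
    congr 2; push_cast; ring
  rw [h1, h2]
  simp only [map_add, Nat.cast_zero, map_zero]
  ring

open Polynomial in
lemma auxP_natDegree (n : ℕ) (s : ℂ) (i : ℕ) (hi : i ≤ n) : (auxP n s i).natDegree ≤ n := by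
  unfold auxP
  refine natDegree_mul_le.trans ?_
  have a := natDegree_prod_le (Finset.range i) (fun k : ℕ => (X - C (k : ℂ)))
  have b := natDegree_prod_le (Finset.range (n - i)) (fun k : ℕ => (C (s + i + 1 + k) - X))
  have b' : ∀ c : ℂ, (C c - X).natDegree = 1 := fun c => by
    rw [← neg_sub, natDegree_neg, natDegree_X_sub_C]
  simp only [natDegree_X_sub_C, b', Finset.sum_const, Finset.card_range,
    smul_eq_mul, mul_one] at a b
  omega

open Polynomial in
lemma auxP_coeff (n : ℕ) (s : ℂ) : (auxP n s 0).coeff n = (-1) ^ n := by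
  have h : auxP n s 0 = C ((-1) ^ n) * ∏ k ∈ Finset.range n, (X - C (s + 1 + k)) := by
    unfold auxP
    rw [map_pow]
    have : (C (-1 : ℂ)) ^ n = ∏ k ∈ Finset.range n, (C (-1 : ℂ)) := by simp
    rw [this, ← Finset.prod_mul_distrib]
    simp
  have hm : (∏ k ∈ Finset.range n, (X - C (s + 1 + (k : ℂ)))).Monic :=
    monic_prod_of_monic _ _ fun k _ => monic_X_sub_C _
  have hd : (∏ k ∈ Finset.range n, (X - C (s + 1 + (k : ℂ)))).natDegree = n := by
    rw [natDegree_prod_of_monic _ _ fun k _ => monic_X_sub_C _]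
    simp only [natDegree_X_sub_C, Finset.sum_const, Finset.card_range, smul_eq_mul, mul_one]
  rw [h, coeff_C_mul]
  have := hm.coeff_natDegree
  rw [hd] at this
  rw [this, mul_one]

lemma auxDet (n : ℕ) : ∀ s : ℂ,
    (Matrix.of fun i j : Fin (n + 1) => (auxP n s i).coeff j).det =
      ∏ k ∈ Finset.range n, (s + k + 1) ^ (n - k) := by
  induction n with
  | zero => intro s; simp [auxP]
  | succ n ih =>
    intro s
    set A := (Matrix.of fun i j : Fin (n + 1 + 1) => (auxP (n + 1) s i).coeff j) with hA
    let B : Matrix (Fin (n + 2)) (Fin (n + 2)) ℂ := Matrix.of fun i j =>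
      Fin.cases ((auxP (n + 1) s 0).coeff j)
        (fun i => (s + 1) * (auxP n (s + 1) i).coeff j) i
    have hAB : A.det = B.det := by
      refine Matrix.det_eq_of_forall_row_eq_smul_add_pred (fun _ => -1) (fun j => ?_)
        (fun i j => ?_)
      · simp [A, B]
      · have := congrArg (fun p => p.coeff (j : ℕ)) (auxP_add n s i (by omega))
        simp only [Polynomial.coeff_add, Polynomial.coeff_C_mul] at this
        simp only [A, B, Matrix.of_apply, Fin.cases_succ, Fin.val_succ, Fin.val_castSucc]
        rw [← this]; ring
    rw [hAB, Matrix.det_succ_column B (Fin.last _), Fin.sum_univ_succ, Finset.sum_eq_zero]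
    · have hs : B.submatrix (Fin.succAbove 0) (Fin.last (n + 1)).succAbove =
          (s + 1) • (Matrix.of fun i j : Fin (n + 1) => (auxP n (s + 1) i).coeff j) := by
        ext i j
        simp [B]
      rw [hs, Matrix.det_smul, ih, Finset.prod_range_succ']
      have : B 0 (Fin.last _) = (-1) ^ (n + 1) := by
        simp [B, auxP_coeff]
      rw [this]
      have e : ((-1 : ℂ) ^ (n + 1)) * (-1) ^ (n + 1) = 1 := by
        rw [← mul_pow]; simp
      have e2 : ∏ k ∈ Finset.range n, (s + ((k + 1 : ℕ) : ℂ) + 1) ^ (n + 1 - (k + 1)) =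
          ∏ k ∈ Finset.range n, (s + 1 + k + 1) ^ (n - k) := by
        refine Finset.prod_congr rfl fun k _ => ?_
        rw [Nat.add_sub_add_right]; congr 1; push_cast; ring
      rw [e2]
      simp only [Fin.val_zero, Fin.val_last, zero_add, Fintype.card_fin, e, one_mul, Nat.cast_zero,
        add_zero, Nat.sub_zero]
      ring
    · intro i _
      have : B i.succ (Fin.last _) = 0 := by
        simp only [B, Matrix.of_apply, Fin.cases_succ, Fin.val_last]
        rw [Polynomial.coeff_eq_zero_of_natDegree_lt, mul_zero]
        exact Nat.lt_succ_of_le (auxP_natDegree n (s + 1) i (by omega))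
      rw [this]; ring

lemma auxEval (n : ℕ) (s : ℂ) (x : Fin (n + 1) → ℂ) :
    (Matrix.of fun i j : Fin (n + 1) => (auxP n s i).eval (x j)).det =
      (∏ k ∈ Finset.range n, (s + k + 1) ^ (n - k)) * (Matrix.vandermonde x).det := by
  rw [← auxDet, ← Matrix.det_transpose (Matrix.vandermonde x), ← Matrix.det_mul]
  congr 1
  ext i j
  rw [Matrix.mul_apply, Matrix.of_apply, Polynomial.eval_eq_sum_range' (n := n + 1)
    (Nat.lt_succ_of_le (auxP_natDegree n s i (by omega))), Finset.sum_range]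
  simp [Matrix.vandermonde_apply]

lemma auxG (m : ℕ) (w : ℂ) :
    (Complex.Gamma w)⁻¹ = (∏ k ∈ Finset.range m, (w + k)) * (Complex.Gamma (w + m))⁻¹ := by
  induction m with
  | zero => simp
  | succ m ih =>
    rw [ih, Complex.one_div_Gamma_eq_self_mul_one_div_Gamma_add_one (w + m),
      Finset.prod_range_succ]
    push_cast
    rw [← add_assoc]; ring

lemma auxG' (m : ℕ) (z : ℂ) :
    (Complex.Gamma (z + 1 - m))⁻¹ =
      (∏ k ∈ Finset.range m, (z - k)) * (Complex.Gamma (z + 1))⁻¹ := by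
  induction m with
  | zero => simp
  | succ m ih =>
    rw [Complex.one_div_Gamma_eq_self_mul_one_div_Gamma_add_one, Finset.prod_range_succ]
    have e : z + 1 - ((m + 1 : ℕ) : ℂ) + 1 = z + 1 - m := by push_cast; ring
    rw [e, ih]
    push_cast; ring

lemma auxTri (f : ℕ → ℂ) (n : ℕ) :
    ∏ j ∈ Finset.range (n + 1), ∏ k ∈ Finset.range j, f k =
      ∏ k ∈ Finset.range n, f k ^ (n - k) := by
  induction n with
  | zero => simp
  | succ n ih =>
    rw [Finset.prod_range_succ, ih, Finset.prod_range_succ f n,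
      Finset.prod_range_succ (fun k => f k ^ (n + 1 - k)) n, ← mul_assoc,
      ← Finset.prod_mul_distrib]
    congr 1
    · refine Finset.prod_congr rfl fun k hk => ?_
      rw [Finset.mem_range] at hk
      rw [← pow_succ]; congr 1; omega
    · simp

lemma auxGne (α : ℂ) (hα : ∀ m : ℕ, α ≠ -(m + 1 : ℕ)) (j : ℕ) :
    Complex.Gamma (α + 1) * (Complex.Gamma (α + 1 + j))⁻¹ =
      ∏ k ∈ Finset.range j, (α + (k + 1))⁻¹ := by
  have h1 : Complex.Gamma (α + 1) ≠ 0 := by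
    refine Complex.Gamma_ne_zero fun m h => hα m ?_
    push_cast; linear_combination h
  have h2 : ∏ k ∈ Finset.range j, (α + ((k : ℂ) + 1)) ≠ 0 := by
    refine Finset.prod_ne_zero_iff.2 fun k _ h => hα k ?_
    push_cast; linear_combination h
  have h := auxG j (α + 1)
  have e : ∏ k ∈ Finset.range j, (α + 1 + (k : ℂ)) = ∏ k ∈ Finset.range j, (α + ((k : ℂ) + 1)) :=
    Finset.prod_congr rfl fun k _ => by ring
  rw [e] at h
  rw [Finset.prod_inv_distrib]
  have h3 : (Complex.Gamma (α + 1 + j))⁻¹ =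
      (∏ k ∈ Finset.range j, (α + ((k : ℂ) + 1)))⁻¹ * (Complex.Gamma (α + 1))⁻¹ := by
    rw [h, inv_mul_cancel_left₀ h2]
  rw [h3]; field_simp

lemma auxSf (n : ℕ) : ((Nat.superFactorial n : ℕ) : ℂ) =
    ∏ k ∈ Finset.range n, ((k + 1 : ℕ) : ℂ) ^ (n - k) := by
  rw [← auxTri]
  induction n with
  | zero => simp
  | succ n ih =>
    rw [Nat.superFactorial_succ, Finset.prod_range_succ, ← ih, ← Finset.prod_range_add_one_eq_factorial]
    push_cast; ring

/-- The determinant of `M_{ij} = Γ(α+1)Γ(β+1)/(Γ(α+1-i+j)Γ(β+1+i-j))` equals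
`∏_{k=1}^{n-1} (k (α+β+k) / ((α+k)(β+k)))^{n-k}`. -/
theorem det_M_formula (n : ℕ) (hn : 1 ≤ n) (α β : ℂ)
    (hα : ∀ m : ℕ, α ≠ -(m + 1 : ℕ)) (hβ : ∀ m : ℕ, β ≠ -(m + 1 : ℕ))
    (M : Matrix (Fin n) (Fin n) ℂ)
    (hM : ∀ i j : Fin n, M i j =
      Complex.Gamma (α + 1) * Complex.Gamma (β + 1) *
        (Complex.Gamma (α + 1 - (i : ℤ) + (j : ℤ)))⁻¹ *
        (Complex.Gamma (β + 1 + (i : ℤ) - (j : ℤ)))⁻¹) :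
    M.det = ∏ k ∈ Finset.range (n - 1),
      (((k + 1 : ℕ) : ℂ) * (α + β + (k + 1)) / ((α + (k + 1)) * (β + (k + 1))))
        ^ (n - (k + 1)) := by
  obtain ⟨n, rfl⟩ : ∃ m, n = m + 1 := ⟨n - 1, by omega⟩
  let u : ℕ → ℂ := fun j => ∏ k ∈ Finset.range j, (α + (k + 1))⁻¹
  let v : ℕ → ℂ := fun j => ∏ k ∈ Finset.range j, (β + (k + 1))⁻¹
  have key : M = Matrix.of fun i j : Fin (n + 1) => (u j * v (n - j)) *
      (Matrix.of fun i j : Fin (n + 1) =>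
        (auxP n (α + β) i).eval ((j : ℂ) + α)) i j := by
    ext i j
    have hi : (i : ℕ) ≤ n := by omega
    have hj : (j : ℕ) ≤ n := by omega
    rw [hM]
    simp only [Matrix.of_apply, u, v]
    rw [← auxGne α hα, ← auxGne β hβ]
    have a := auxG' i (α + j)
    have b := auxG (n - i) (β + 1 + i - j)
    have e1 : α + 1 - (((i : ℕ) : ℤ) : ℂ) + (((j : ℕ) : ℤ) : ℂ) = α + (j : ℕ) + 1 - (i : ℕ) := by
      push_cast; ring
    have e2 : β + 1 + (((i : ℕ) : ℤ) : ℂ) - (((j : ℕ) : ℤ) : ℂ) = β + 1 + (i : ℕ) - (j : ℕ) := by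
      push_cast; ring
    have e3 : β + 1 + (i : ℕ) - (j : ℕ) + ((n - i : ℕ) : ℂ) = β + 1 + ((n - j : ℕ) : ℂ) := by
      push_cast [Nat.cast_sub hi, Nat.cast_sub hj]; ring
    have e4 : α + ((j : ℕ) : ℂ) + 1 = α + 1 + (j : ℕ) := by ring
    rw [e1, e2, a, b, e3, e4]
    have p : (auxP n (α + β) i).eval (((j : ℕ) : ℂ) + α) =
        (∏ k ∈ Finset.range i, (α + ((j : ℕ) : ℂ) - k)) *
          ∏ k ∈ Finset.range (n - i), (β + 1 + (i : ℕ) - (j : ℕ) + (k : ℂ)) := by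
      unfold auxP
      rw [Polynomial.eval_mul, Polynomial.eval_prod, Polynomial.eval_prod]
      congr 1
      · refine Finset.prod_congr rfl fun k _ => ?_
        simp; ring
      · refine Finset.prod_congr rfl fun k _ => ?_
        simp; ring
    rw [p]; ring
  have hu : ∏ j : Fin (n + 1), (u j * v (n - j)) =
      (∏ k ∈ Finset.range n, (α + (k + 1))⁻¹ ^ (n - k)) *
      (∏ k ∈ Finset.range n, (β + (k + 1))⁻¹ ^ (n - k)) := by
    rw [← auxTri, ← auxTri, ← Finset.prod_range (fun j => u j * v (n - j)),
      Finset.prod_mul_distrib]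
    congr 1
    have := Finset.prod_range_reflect v (n + 1)
    simpa [v] using this
  rw [key, Matrix.det_mul_row, auxEval, hu, Matrix.det_vandermonde_add,
    Matrix.det_vandermonde_id_eq_superFactorial, auxSf, ← Finset.prod_mul_distrib,
    ← Finset.prod_mul_distrib, ← Finset.prod_mul_distrib]
  refine Finset.prod_congr rfl fun k _ => ?_
  rw [Nat.add_sub_add_right, ← mul_pow, ← mul_pow, ← mul_pow]
  congr 1
  rw [div_eq_mul_inv, mul_inv]
  ring
end

section
/- Let n ≥ 1 be an integer, let β ∈ ℂ, and let k be an integer with 1 ≤ k ≤ n-1. Then the n×n matrix N with (i,j) entry (1 ≤ i,j ≤ n) equal to (1/Γ(α+1-i+j)) · (1/Γ(β+1+i-j)), evaluated at α = -β-k, has rank at most k. -/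
open Complex

lemma aux_poly (m : ℕ) : ∃ P : Polynomial ℂ, P.natDegree ≤ m ∧ ∀ z : ℂ,
    (Complex.Gamma (1 - m - z))⁻¹ * (Complex.Gamma z)⁻¹ =
      Complex.sin (Real.pi * z) / Real.pi * P.eval z := by
  induction m with
  | zero =>
    refine ⟨1, by simp, fun z => ?_⟩
    have h := Complex.Gamma_mul_Gamma_one_sub z
    rw [← mul_inv, Nat.cast_zero, sub_zero, mul_comm, h]
    simp
  | succ m ih =>
    obtain ⟨P, hP, h⟩ := ih
    refine ⟨(-(Polynomial.X + Polynomial.C (m : ℂ))) * P, ?_, fun z => ?_⟩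
    · refine Polynomial.natDegree_mul_le.trans ?_
      rw [Polynomial.natDegree_neg, Polynomial.natDegree_X_add_C]
      omega
    · have h1 := Complex.one_div_Gamma_eq_self_mul_one_div_Gamma_add_one (1 - ((m + 1 : ℕ) : ℂ) - z)
      have e : (1 - ((m + 1 : ℕ) : ℂ) - z) + 1 = 1 - m - z := by push_cast; ring
      rw [e] at h1
      rw [h1, mul_assoc, h z]
      simp only [Polynomial.eval_mul, Polynomial.eval_neg, Polynomial.eval_add,
        Polynomial.eval_X, Polynomial.eval_C]
      push_cast
      ring

lemma aux_sin (w : ℂ) (i : ℕ) :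
    Complex.sin (Real.pi * (w + i)) = (-1) ^ i * Complex.sin (Real.pi * w) := by
  induction i with
  | zero => simp
  | succ i ih =>
    have e : (Real.pi : ℂ) * (w + ((i + 1 : ℕ) : ℂ)) = Real.pi * (w + i) + Real.pi := by
      push_cast; ring
    rw [e, Complex.sin_add_pi, ih]
    ring

/-- At `α = -β - k` (for `1 ≤ k ≤ n-1`), the matrix with entries
`1/(Γ(α+1-i+j) Γ(β+1+i-j))` has rank at most `k`. -/
theorem rank_le_of_alpha_eq (n : ℕ) (hn : 1 ≤ n) (β : ℂ) (k : ℕ)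
    (hk1 : 1 ≤ k) (hk2 : k ≤ n - 1)
    (N : Matrix (Fin n) (Fin n) ℂ)
    (hN : ∀ i j : Fin n, N i j =
      (Complex.Gamma ((-β - k) + 1 - (i : ℤ) + (j : ℤ)))⁻¹ *
        (Complex.Gamma (β + 1 + (i : ℤ) - (j : ℤ)))⁻¹) :
    N.rank ≤ k := by
  obtain ⟨m, rfl⟩ : ∃ m, k = m + 1 := ⟨k - 1, by omega⟩
  obtain ⟨P, hP, h⟩ := aux_poly m
  let A : Matrix (Fin n) (Fin (m + 1)) ℂ := fun i a =>
    (-1) ^ (i : ℕ) * (β + 1 + (i : ℕ)) ^ (a : ℕ)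
  let B : Matrix (Fin (m + 1)) (Fin n) ℂ := fun a j =>
    Complex.sin (Real.pi * (β + 1 - (j : ℕ))) / Real.pi *
      (Polynomial.taylor (-((j : ℕ) : ℂ)) P).coeff a
  have hAB : N = A * B := by
    ext i j
    rw [hN, Matrix.mul_apply]
    have e1 : (-β - ((m + 1 : ℕ) : ℂ)) + 1 - (((i : ℕ) : ℤ) : ℂ) + (((j : ℕ) : ℤ) : ℂ)
        = 1 - m - ((β + 1 - (j : ℕ)) + (i : ℕ)) := by push_cast; ring
    have e2 : β + 1 + (((i : ℕ) : ℤ) : ℂ) - (((j : ℕ) : ℤ) : ℂ)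
        = (β + 1 - (j : ℕ)) + (i : ℕ) := by push_cast; ring
    rw [e1, e2, h, aux_sin]
    have e3 : P.eval ((β + 1 - (j : ℕ)) + (i : ℕ)) =
        ∑ a : Fin (m + 1), (Polynomial.taylor (-((j : ℕ) : ℂ)) P).coeff a *
          (β + 1 + (i : ℕ)) ^ (a : ℕ) := by
      rw [Fin.sum_univ_eq_sum_range (fun a => (Polynomial.taylor (-((j : ℕ) : ℂ)) P).coeff a *
          (β + 1 + (i : ℕ)) ^ a), ← Polynomial.eval_eq_sum_range' (n := m + 1)
          (by rw [Polynomial.natDegree_taylor]; omega), Polynomial.taylor_eval]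
      congr 1
      ring
    rw [e3, Finset.mul_sum]
    refine Finset.sum_congr rfl fun a _ => ?_
    simp only [A, B]
    ring
  rw [hAB]
  exact (Matrix.rank_mul_le_left A B).trans ((Matrix.rank_le_width A))
end

section
/- Let n ≥ 1 be an integer, let β ∈ ℂ, and let k be an integer with 1 ≤ k ≤ n-1. Define f : ℂ → ℂ by f(α) = det of the n×n matrix with (i,j) entry (1 ≤ i,j ≤ n) equal to (1/Γ(α+1-i+j)) · (1/Γ(β+1+i-j)). Then for every natural number m with m ≤ n-k-1, the m-th derivative of f at the point α = -β-k is zero; that is, f has a zero of order at least n-k at α = -β-k. -/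
open Complex

lemma aux_poch (m : ℕ) (s : ℂ) :
    (Complex.Gamma s)⁻¹ = (ascPochhammer ℂ m).eval s * (Complex.Gamma (s + m))⁻¹ := by
  induction m with
  | zero => simp
  | succ m ih =>
    rw [ih, ascPochhammer_succ_eval, one_div_Gamma_eq_self_mul_one_div_Gamma_add_one (s + m)]
    push_cast
    rw [mul_assoc, add_assoc]

lemma aux_det_differentiable {ι : Type*} [Fintype ι] [DecidableEq ι]
    (M : ℂ → Matrix ι ι ℂ) (h : ∀ i j, Differentiable ℂ (fun z => M z i j)) :
    Differentiable ℂ (fun z => (M z).det) := by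
  simp only [Matrix.det_apply]
  refine Differentiable.fun_sum fun σ _ => ?_
  refine Differentiable.const_smul (Differentiable.fun_finsetProd fun i _ => ?_) _
  exact h _ _

lemma aux_block (n k : ℕ) (hk : k ≤ n) (U : Matrix (Fin n) (Fin k) ℂ)
    (V : Matrix (Fin k) (Fin n) ℂ) (B : Matrix (Fin n) (Fin n) ℂ) (t : ℂ) (ht : t ≠ 0) :
    (U * V + t • B).det =
      t ^ (n - k) * (Matrix.fromBlocks (t • (1 : Matrix (Fin k) (Fin k) ℂ)) (-V) U B).det := by
  let inst : Invertible (t • (1 : Matrix (Fin k) (Fin k) ℂ)) :=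
    ⟨t⁻¹ • 1, by simp [smul_smul, ht], by simp [smul_smul, ht]⟩
  have hi : ⅟(t • (1 : Matrix (Fin k) (Fin k) ℂ)) = t⁻¹ • 1 := rfl
  rw [Matrix.det_fromBlocks₁₁, hi]
  have h1 : U * V + t • B = t • (B - U * (t⁻¹ • (1 : Matrix (Fin k) (Fin k) ℂ)) * (-V)) := by
    simp [smul_sub, smul_smul, ht, add_comm]
  rw [h1, Matrix.det_smul, Matrix.det_smul, Matrix.det_one, mul_one, ← mul_assoc, ← pow_add]
  simp [Nat.sub_add_cancel hk]

lemma aux_order (n k : ℕ) (hk : k ≤ n) (A : ℂ → Matrix (Fin n) (Fin n) ℂ) (z₀ : ℂ)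
    (hA : ∀ i j, Differentiable ℂ (fun z => A z i j))
    (U : Matrix (Fin n) (Fin k) ℂ) (V : Matrix (Fin k) (Fin n) ℂ) (hUV : A z₀ = U * V) :
    ∀ m < n - k, iteratedDeriv m (fun z => (A z).det) z₀ = 0 := by
  have hf := aux_det_differentiable A hA
  rw [← natCast_le_analyticOrderAt_iff_iteratedDeriv_eq_zero (hf.analyticAt z₀),
    natCast_le_analyticOrderAt (hf.analyticAt z₀)]
  let B : ℂ → Matrix (Fin n) (Fin n) ℂ := fun z => Matrix.of fun i j =>
    dslope (fun z => A z i j) z₀ z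
  have hB : ∀ i j, Differentiable ℂ (fun z => B z i j) := fun i j => by
    have := (Complex.differentiableOn_dslope (f := fun z => A z i j) (c := z₀)
      (s := Set.univ) Filter.univ_mem).2 (hA i j).differentiableOn
    exact differentiableOn_univ.1 this
  have hg : Differentiable ℂ (fun z => (Matrix.fromBlocks
      ((z - z₀) • (1 : Matrix (Fin k) (Fin k) ℂ)) (-V) U (B z)).det) := by
    apply aux_det_differentiable
    rintro (i | i) (j | j)
    · simp only [Matrix.fromBlocks_apply₁₁, Matrix.smul_apply, smul_eq_mul]
      fun_prop
    · simp
    · simp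
    · simpa using hB i j
  refine ⟨_, hg.analyticAt z₀, ?_⟩
  have han : AnalyticAt ℂ (fun z => (z - z₀) ^ (n - k) • (Matrix.fromBlocks
      ((z - z₀) • (1 : Matrix (Fin k) (Fin k) ℂ)) (-V) U (B z)).det) z₀ :=
    Differentiable.analyticAt (by fun_prop) z₀
  refine ((hf.analyticAt z₀).frequently_eq_iff_eventually_eq han).1 ?_
  refine Filter.Eventually.frequently ?_
  filter_upwards [self_mem_nhdsWithin] with z hz
  have hz' : z - z₀ ≠ 0 := sub_ne_zero.2 hz
  rw [smul_eq_mul, ← aux_block n k hk U V (B z) _ hz', ← hUV]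
  congr 1
  ext i j
  have := sub_smul_dslope (fun z => A z i j) z₀ z
  simp only [Matrix.add_apply, Matrix.smul_apply, B, Matrix.of_apply]
  rw [this]; ring

lemma aux_entry (β : ℂ) (k : ℕ) (hk1 : 1 ≤ k) (i j : ℕ) :
    (Complex.Gamma (-β - k + 1 - i + j))⁻¹ * (Complex.Gamma (β + 1 + i - j))⁻¹ =
      ((-1) ^ i * (-1) ^ j * (Complex.sin (Real.pi * (-β - k + 1)) / Real.pi)) *
        (ascPochhammer ℂ (k - 1)).eval (β + 1 + i - j) := by
  rw [aux_poch (k - 1) (β + 1 + i - j)]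
  have e : β + 1 + i - j + ((k - 1 : ℕ) : ℂ) = 1 - (-β - k + 1 - i + j) := by
    push_cast [hk1]; ring
  have h := Complex.Gamma_mul_Gamma_one_sub (-β - k + 1 - i + j)
  have hs : Complex.sin (Real.pi * (-β - k + 1 - i + j)) =
      (-1) ^ i * (-1) ^ j * Complex.sin (Real.pi * (-β - k + 1)) := by
    rw [show (Real.pi : ℂ) * (-β - k + 1 - i + j) =
      Real.pi * (-β - k + 1) - i * Real.pi + j * Real.pi by ring,
      Complex.sin_antiperiodic.add_nat_mul_eq, Complex.sin_antiperiodic.sub_nat_mul_eq]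
    ring
  rw [e, mul_left_comm, ← mul_inv, h, hs, inv_div]
  ring

/-- The determinant `f(α) = det(1/(Γ(α+1-i+j)Γ(β+1+i-j)))` has a zero of order at
least `n - k` at `α = -β - k`, for `1 ≤ k ≤ n-1`: all derivatives of order
`m ≤ n - k - 1` vanish there. -/
theorem det_zero_order (n : ℕ) (hn : 1 ≤ n) (β : ℂ) (k : ℕ)
    (hk1 : 1 ≤ k) (hk2 : k ≤ n - 1)
    (f : ℂ → ℂ)
    (hf : ∀ α : ℂ, f α = Matrix.det (fun i j : Fin n =>
      (Complex.Gamma (α + 1 - (i : ℤ) + (j : ℤ)))⁻¹ *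
        (Complex.Gamma (β + 1 + (i : ℤ) - (j : ℤ)))⁻¹)) :
    ∀ m : ℕ, m ≤ n - k - 1 → iteratedDeriv m f (-β - k) = 0 := by
  intro m hm
  obtain rfl : f = _ := funext hf
  let p : ℕ → Polynomial ℂ := fun j =>
    (ascPochhammer ℂ (k - 1)).comp (Polynomial.X + Polynomial.C (β + 1 - j))
  have hp : ∀ j, (p j).natDegree < k := fun j => by
    simp only [p, Polynomial.natDegree_comp, ascPochhammer_natDegree,
      Polynomial.natDegree_X_add_C]
    omega
  refine aux_order n k (by omega) _ (-β - k) ?_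
    (Matrix.of fun i l => (-1) ^ (i : ℕ) * ((i : ℕ) : ℂ) ^ (l : ℕ))
    (Matrix.of fun l j => (-1) ^ (j : ℕ) * (Complex.sin (Real.pi * (-β - k + 1)) / Real.pi) *
      (p j).coeff l) ?_ m (by omega)
  · intro i j
    refine Differentiable.mul_const ?_ _
    exact Complex.differentiable_one_div_Gamma.comp
      (f := fun z : ℂ => z + 1 - ((i : ℤ) : ℂ) + ((j : ℤ) : ℂ)) (by fun_prop)
  · ext i j
    have h := aux_entry β k hk1 i j
    simp only [Int.cast_natCast, Matrix.mul_apply, Matrix.of_apply]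
    rw [h]
    have e : (ascPochhammer ℂ (k - 1)).eval (β + 1 + (i : ℕ) - (j : ℕ)) =
        (p j).eval ((i : ℕ) : ℂ) := by
      simp only [p, Polynomial.eval_comp, Polynomial.eval_add, Polynomial.eval_X,
        Polynomial.eval_C]
      congr 1; ring
    rw [e, Polynomial.eval_eq_sum_range' (hp j), ← Fin.sum_univ_eq_sum_range
      (fun l => (p j).coeff l * ((i : ℕ) : ℂ) ^ l), Finset.mul_sum]
    refine Finset.sum_congr rfl fun l _ => ?_
    ring
end

section
/- For every natural number k, all α, β ∈ ℂ, and every integer d: ∑_{m=0}^{k} C(k,m) · (1/Γ(α+1-d+m)) · (1/Γ(β+1+d-m)) = [∏_{ℓ=1}^{k} (α+β+ℓ)] · (1/Γ(α+k+1-d)) · (1/Γ(β+1+d)), where C(k,m) is the binomial coefficient. -/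
open Complex Finset

theorem aux_pascal (k : ℕ) (f : ℕ → ℂ) :
    ∑ m ∈ Finset.range (k + 1 + 1), ((k + 1).choose m : ℂ) * f m =
      ∑ m ∈ Finset.range (k + 1), (k.choose m : ℂ) * f m +
      ∑ m ∈ Finset.range (k + 1), (k.choose m : ℂ) * f (m + 1) := by
  have h : ∑ m ∈ Finset.range (k + 1), (k.choose m : ℂ) * f m =
      ∑ m ∈ Finset.range (k + 1 + 1), (k.choose m : ℂ) * f m := by
    rw [Finset.sum_range_succ _ (k + 1)]
    simp
  rw [h, Finset.sum_range_succ', Finset.sum_range_succ' _ (k + 1)]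
  simp only [Nat.choose_succ_succ, Nat.cast_add, add_mul, Finset.sum_add_distrib]
  simp
  ring

theorem aux_main (k : ℕ) : ∀ a b : ℂ,
    ∑ m ∈ Finset.range (k + 1),
        (k.choose m : ℂ) * ((Complex.Gamma (a + m))⁻¹ * (Complex.Gamma (b - m))⁻¹) =
      (∏ ℓ ∈ Finset.range k, (a + b - 1 + ℓ)) *
        (Complex.Gamma (a + k))⁻¹ * (Complex.Gamma b)⁻¹ := by
  induction k with
  | zero => intro a b; simp
  | succ k ih =>
    intro a b
    have h2 := ih (a + 1) (b - 1)
    have e1 : ∀ m : ℕ, a + ((m + 1 : ℕ) : ℂ) = a + 1 + m := fun m => by push_cast; ring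
    have e2 : ∀ m : ℕ, b - ((m + 1 : ℕ) : ℂ) = b - 1 - m := fun m => by push_cast; ring
    rw [aux_pascal k (fun m => (Complex.Gamma (a + m))⁻¹ * (Complex.Gamma (b - m))⁻¹)]
    simp only [e1, e2]
    rw [ih a b, h2, Finset.prod_range_succ]
    have g1 := Complex.one_div_Gamma_eq_self_mul_one_div_Gamma_add_one (a + k)
    have g2 := Complex.one_div_Gamma_eq_self_mul_one_div_Gamma_add_one (b - 1)
    rw [show a + k + 1 = a + 1 + k by ring] at g1
    rw [sub_add_cancel] at g2
    rw [g1, g2, show a + 1 + (b - 1) - 1 = a + b - 1 by ring]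
    ring

/-- The `k`-fold iterated row-operation identity:
`∑_{m=0}^{k} C(k,m)/(Γ(α+1-d+m)Γ(β+1+d-m)) = ∏_{ℓ=1}^{k}(α+β+ℓ) / (Γ(α+k+1-d)Γ(β+1+d))`. -/
theorem reciprocal_gamma_binomial_identity (k : ℕ) (α β : ℂ) (d : ℤ) :
    ∑ m ∈ Finset.range (k + 1),
        (k.choose m : ℂ) * (Complex.Gamma (α + 1 - d + m))⁻¹ *
          (Complex.Gamma (β + 1 + d - m))⁻¹ =
      (∏ ℓ ∈ Finset.range k, (α + β + (ℓ + 1))) *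
        (Complex.Gamma (α + k + 1 - d))⁻¹ * (Complex.Gamma (β + 1 + d))⁻¹ := by
  have h := aux_main k (α + 1 - d) (β + 1 + d)
  simp only [mul_assoc] at h ⊢
  rw [h]
  congr 1
  · refine Finset.prod_congr rfl fun l _ => ?_
    ring
  · rw [show α + 1 - d + k = α + k + 1 - d by ring]
end

section
/- Let n ≥ 1 and α, β ∈ ℂ. Then det((1/Γ(α+1-i+j)) · (1/Γ(β+1+i-j)))_{i,j=1}^n = [∏_{ℓ=1}^{n} (1/Γ(α+ℓ)) · (1/Γ(β+ℓ))] · det(∏_{ℓ=1}^{n-j} (α-i+j+ℓ) · ∏_{m=1}^{n-i} (β+i-j+m))_{i,j=1}^n, and this holds for all complex α, β. -/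
open Complex Finset

theorem inv_Gamma_shift (z : ℂ) (k : ℕ) :
    (Complex.Gamma (z + 1))⁻¹ =
      (Complex.Gamma (z + (k + 1)))⁻¹ * ∏ l ∈ Finset.range k, (z + (l + 1)) := by
  induction k with
  | zero => simp
  | succ k ih =>
    rw [ih, Complex.one_div_Gamma_eq_self_mul_one_div_Gamma_add_one, Finset.prod_range_succ]
    push_cast
    rw [show z + ((k : ℂ) + 1) + 1 = z + (k + 1 + 1) by ring]
    ring

theorem prod_fin_reflect (n : ℕ) (f : ℕ → ℂ) :
    ∏ i : Fin n, f (n - 1 - (i : ℕ)) = ∏ l ∈ Finset.range n, f l := by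
  rw [Fin.prod_univ_eq_prod_range (fun i => f (n - 1 - i)) n, Finset.prod_range_reflect]

theorem det_scale (n : ℕ) (r c : Fin n → ℂ) (A B : Matrix (Fin n) (Fin n) ℂ)
    (h : ∀ i j, A i j = r i * (c j * B i j)) :
    A.det = (∏ i, r i) * ((∏ i, c i) * B.det) := by
  rw [← Matrix.det_mul_row, ← Matrix.det_mul_column]
  congr 1
  ext i j
  simp only [Matrix.of_apply, h]

/-- Extracting `1/Γ(α+1+n-i)` from row `i` and `1/Γ(β+1+n-j)` from column `j`:
`det(1/(Γ(α+1-i+j)Γ(β+1+i-j))) = ∏_{ℓ=1}^n 1/(Γ(α+ℓ)Γ(β+ℓ)) · D_n(α,β)`, where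
`D_n(α,β)` has entries `∏_{ℓ=1}^{n-j}(α-i+j+ℓ) ∏_{m=1}^{n-i}(β+i-j+m)` (with
`1 ≤ i,j ≤ n`). -/
theorem det_extract_gamma_factors (n : ℕ) (hn : 1 ≤ n) (α β : ℂ) :
    Matrix.det (fun i j : Fin n =>
        (Complex.Gamma (α + 1 - (i : ℤ) + (j : ℤ)))⁻¹ *
          (Complex.Gamma (β + 1 + (i : ℤ) - (j : ℤ)))⁻¹) =
      (∏ ℓ ∈ Finset.range n,
          (Complex.Gamma (α + (ℓ + 1)))⁻¹ * (Complex.Gamma (β + (ℓ + 1)))⁻¹) *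
      Matrix.det (fun i j : Fin n =>
        (∏ ℓ ∈ Finset.range (n - 1 - (j : ℕ)), (α - (i : ℤ) + (j : ℤ) + (ℓ + 1))) *
          ∏ m ∈ Finset.range (n - 1 - (i : ℕ)), (β + (i : ℤ) - (j : ℤ) + (m + 1))) := by
  rw [Finset.prod_mul_distrib,
    ← prod_fin_reflect n (fun l => (Complex.Gamma (α + ((l : ℂ) + 1)))⁻¹),
    ← prod_fin_reflect n (fun l => (Complex.Gamma (β + ((l : ℂ) + 1)))⁻¹),
    mul_assoc]
  refine det_scale n _ _ _ _ (fun i j => ?_)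
  beta_reduce
  have hi : ((n - 1 - (i : ℕ) : ℕ) : ℂ) = n - 1 - (i : ℕ) := by
    rw [Nat.cast_sub (by omega), Nat.cast_sub hn, Nat.cast_one]
  have hj : ((n - 1 - (j : ℕ) : ℕ) : ℂ) = n - 1 - (j : ℕ) := by
    rw [Nat.cast_sub (by omega), Nat.cast_sub hn, Nat.cast_one]
  have h1 := inv_Gamma_shift (α - (i : ℤ) + (j : ℤ)) (n - 1 - (j : ℕ))
  have h2 := inv_Gamma_shift (β + (i : ℤ) - (j : ℤ)) (n - 1 - (i : ℕ))
  rw [show α - ((i : ℤ) : ℂ) + ((j : ℤ) : ℂ) + (((n - 1 - (j : ℕ) : ℕ) : ℂ) + 1)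
      = α + (((n - 1 - (i : ℕ) : ℕ) : ℂ) + 1) by rw [hi, hj]; push_cast; ring] at h1
  rw [show β + ((i : ℤ) : ℂ) - ((j : ℤ) : ℂ) + (((n - 1 - (i : ℕ) : ℕ) : ℂ) + 1)
      = β + (((n - 1 - (j : ℕ) : ℕ) : ℂ) + 1) by rw [hi, hj]; push_cast; ring] at h2
  rw [show α + 1 - ((i : ℤ) : ℂ) + ((j : ℤ) : ℂ) = α - ((i : ℤ) : ℂ) + ((j : ℤ) : ℂ) + 1 by ring,
    show β + 1 + ((i : ℤ) : ℂ) - ((j : ℤ) : ℂ) = β + ((i : ℤ) : ℂ) - ((j : ℤ) : ℂ) + 1 by ring,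
    h1, h2]
  ring
end

section
/- For n ≥ 2 and α, β ∈ ℂ, define D_n(α,β) = det(∏_{ℓ=1}^{n-j} (α-i+j+ℓ) · ∏_{m=1}^{n-i} (β+i-j+m))_{i,j=1}^n. Then D_n(α,β) = (n-1)! · (α+β+1)^{n-1} · D_{n-1}(α+1, β). -/
open Complex Finset

/-- The `n×n` matrix of polynomials whose `(i,j)` entry (with `1 ≤ i,j ≤ n`,
realized here via `Fin n` by `i ↦ i+1`, `j ↦ j+1`) is
`∏_{ℓ=1}^{n-j}(α-i+j+ℓ) · ∏_{m=1}^{n-i}(β+i-j+m)`. -/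
noncomputable def fhPolyMatrix (n : ℕ) (α β : ℂ) : Matrix (Fin n) (Fin n) ℂ :=
  fun i j =>
    (∏ ℓ ∈ Finset.range (n - 1 - (j : ℕ)), (α - (i : ℤ) + (j : ℤ) + (ℓ + 1))) *
      ∏ m ∈ Finset.range (n - 1 - (i : ℕ)), (β + (i : ℤ) - (j : ℤ) + (m + 1))

lemma fh_colop {N : ℕ} (M : Matrix (Fin (N+1)) (Fin (N+1)) ℂ) (c : Fin N → ℂ)
    (h0 : ∀ j : Fin N, M (Fin.last N) j.castSucc = c j * M (Fin.last N) j.succ)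
    (h1 : M (Fin.last N) (Fin.last N) = 1) :
    M.det = (Matrix.of fun i j : Fin N =>
      M i.castSucc j.castSucc - c j * M i.castSucc j.succ).det := by
  let U : Matrix (Fin (N+1)) (Fin (N+1)) ℂ := Matrix.of fun k j =>
    Fin.lastCases (motive := fun _ => ℂ) (if k = Fin.last N then 1 else 0)
      (fun j => (if k = j.castSucc then 1 else 0) - (if k = j.succ then c j else 0)) j
  have hU : U.det = 1 := by
    rw [Matrix.det_of_lowerTriangular]
    · apply Finset.prod_eq_one
      intro j _
      induction j using Fin.lastCases with
      | last => simp [U]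
      | cast j =>
        have : j.castSucc ≠ j.succ := Fin.castSucc_lt_succ.ne
        simp [U, this]
    · intro k j hkj
      have hkj' : k < j := by simpa using hkj
      induction j using Fin.lastCases with
      | last => simp [U, hkj'.ne]
      | cast j =>
        have : k ≠ j.succ := (hkj'.trans Fin.castSucc_lt_succ).ne
        simp [U, this, hkj'.ne]
  have e1 : ∀ i (j : Fin N), (M * U) i j.castSucc = M i j.castSucc - c j * M i j.succ := by
    intro i j
    simp [Matrix.mul_apply, U, mul_sub, Finset.sum_sub_distrib, mul_comm]
  have e2 : ∀ i, (M * U) i (Fin.last N) = M i (Fin.last N) := by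
    intro i
    simp [Matrix.mul_apply, U]
  have : M.det = (M * U).det := by rw [Matrix.det_mul, hU, mul_one]
  rw [this, Matrix.det_succ_row _ (Fin.last N), Fin.sum_univ_castSucc]
  rw [Finset.sum_eq_zero]
  · rw [e2, h1]
    have hs : (-1 : ℂ) ^ (N + N) = 1 := Even.neg_one_pow ⟨N, rfl⟩
    simp only [Fin.val_last, hs, zero_add, one_mul]
    congr 1
    ext i j
    simp [e1]
  · intro j _
    rw [e1, h0]
    simp

lemma fh_fact (N : ℕ) : ∏ i : Fin N, ((N : ℂ) - (i : ℕ)) = (N.factorial : ℂ) := by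
  rw [Fin.prod_univ_eq_prod_range (fun i => (N : ℂ) - (i : ℕ)) N,
    ← Finset.prod_range_reflect, ← Finset.prod_range_add_one_eq_factorial]
  push_cast
  apply Finset.prod_congr rfl
  intro i hi
  have : i + 1 ≤ N := Finset.mem_range.1 hi
  rw [Nat.sub_sub, Nat.cast_sub (by omega)]
  push_cast
  ring

/-- The recursion `D_n(α,β) = (n-1)! (α+β+1)^{n-1} D_{n-1}(α+1,β)` for the
polynomial determinant of the second proof. -/
theorem fhPolyDet_recursion (n : ℕ) (hn : 2 ≤ n) (α β : ℂ) :
    (fhPolyMatrix n α β).det =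
      ((n - 1).factorial : ℂ) * (α + β + 1) ^ (n - 1) *
        (fhPolyMatrix (n - 1) (α + 1) β).det := by
  obtain ⟨N, rfl⟩ : ∃ N, n = N + 1 := ⟨n - 1, by omega⟩
  rw [Nat.add_sub_cancel]
  rw [fh_colop (fhPolyMatrix (N+1) α β) (fun j => α - N + (j : ℕ) + 1)]
  · have hM : (Matrix.of fun i j : Fin N =>
      fhPolyMatrix (N+1) α β i.castSucc j.castSucc -
        (α - N + (j : ℕ) + 1) * fhPolyMatrix (N+1) α β i.castSucc j.succ) =
      Matrix.of fun i j : Fin N =>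
        (((N : ℂ) - (i : ℕ)) * (α + β + 1)) * fhPolyMatrix N (α + 1) β i j := by
      ext i j
      obtain ⟨a, ha⟩ : ∃ a, N = i + a + 1 := ⟨N - i - 1, by omega⟩
      obtain ⟨b, hb⟩ : ∃ b, N = j + b + 1 := ⟨N - j - 1, by omega⟩
      have hac : (N : ℂ) = (i : ℕ) + a + 1 := by exact_mod_cast ha
      simp only [Matrix.of_apply, fhPolyMatrix, Fin.val_castSucc, Fin.val_succ]
      rw [show N + 1 - 1 - (j : ℕ) = b + 1 by omega, show N + 1 - 1 - (i : ℕ) = a + 1 by omega,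
        show N + 1 - 1 - ((j : ℕ) + 1) = b by omega, show N - 1 - (j : ℕ) = b by omega,
        show N - 1 - (i : ℕ) = a by omega]
      rw [Finset.prod_range_succ' _ b, Finset.prod_range_succ _ a, Finset.prod_range_succ' _ a]
      have q1 : ∏ k ∈ Finset.range b, (α - ((i : ℕ) : ℤ) + ((j : ℕ) : ℤ) + (((k + 1 : ℕ) : ℂ) + 1)) =
          ∏ k ∈ Finset.range b, (α + 1 - ((i : ℕ) : ℤ) + ((j : ℕ) : ℤ) + ((k : ℂ) + 1)) :=
        Finset.prod_congr rfl fun k _ => by push_cast; ring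
      have q2 : ∏ k ∈ Finset.range b, (α - ((i : ℕ) : ℤ) + (((j : ℕ) + 1 : ℕ) : ℤ) + ((k : ℂ) + 1)) =
          ∏ k ∈ Finset.range b, (α + 1 - ((i : ℕ) : ℤ) + ((j : ℕ) : ℤ) + ((k : ℂ) + 1)) :=
        Finset.prod_congr rfl fun k _ => by push_cast; ring
      have q3 : ∏ k ∈ Finset.range a, (β + ((i : ℕ) : ℤ) - (((j : ℕ) + 1 : ℕ) : ℤ) + (((k + 1 : ℕ) : ℂ) + 1)) =
          ∏ k ∈ Finset.range a, (β + ((i : ℕ) : ℤ) - ((j : ℕ) : ℤ) + ((k : ℂ) + 1)) :=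
        Finset.prod_congr rfl fun k _ => by push_cast; ring
      rw [q1, q2, q3, hac]
      push_cast
      ring
    rw [hM]
    have := Matrix.det_mul_column (fun i : Fin N => ((N : ℂ) - (i : ℕ)) * (α + β + 1))
      (fhPolyMatrix N (α + 1) β)
    rw [this, Finset.prod_mul_distrib, fh_fact]
    simp
  · intro j
    obtain ⟨b, hb⟩ : ∃ b, N = j + b + 1 := ⟨N - j - 1, by omega⟩
    simp only [fhPolyMatrix, Fin.val_castSucc, Fin.val_succ, Fin.val_last]
    rw [show N + 1 - 1 - (j : ℕ) = b + 1 by omega, show N + 1 - 1 - N = 0 by omega,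
        show N + 1 - 1 - ((j : ℕ) + 1) = b by omega, Finset.prod_range_succ' _ b]
    simp only [Finset.prod_range_zero, mul_one]
    rw [mul_comm]
    congr 1
    · push_cast; ring
    · exact Finset.prod_congr rfl fun k _ => by push_cast; ring
  · simp [fhPolyMatrix]
end

section
/- For every integer n ≥ 1 and all α, β ∈ ℂ: det(∏_{ℓ=1}^{n-j} (α-i+j+ℓ) · ∏_{m=1}^{n-i} (β+i-j+m))_{i,j=1}^n = ∏_{k=1}^{n-1} (n-k)! · (α+β+k)^{n-k}. -/
open Complex Finset

/-- Rising product `(x+1)...(x+k)`. -/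
noncomputable def rf (x : ℂ) (k : ℕ) : ℂ := ∏ l ∈ Finset.range k, (x + (l + 1))

lemma rf_add (x : ℂ) (a b : ℕ) : rf x (a + b) = rf x a * rf (x + a) b := by
  unfold rf
  rw [Finset.prod_range_add]
  congr 1
  refine Finset.prod_congr rfl fun l _ => ?_
  push_cast; ring

lemma rf_succ_left (x : ℂ) (k : ℕ) : rf x (k + 1) = (x + 1) * rf (x + 1) k := by
  rw [add_comm, rf_add]
  simp [rf]

lemma rf_shift (x : ℂ) (k : ℕ) : (x + k) * rf (x - 1) k = x * rf x k := by
  have h1 := rf_succ_left (x - 1) k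
  have h2 : rf (x - 1) (k + 1) = rf (x - 1) k * (x + k) := by
    unfold rf
    rw [Finset.prod_range_succ]
    congr 1
    ring
  rw [h2] at h1
  rw [sub_add_cancel] at h1
  rw [← h1]; ring

lemma rf_swap (a : ℂ) (N i j : ℕ) (hi : i ≤ N) (hj : j ≤ N) :
    rf a j * rf (a - i + j) (N - j) = rf a (N - i) * rf (a - i + j) i := by
  rcases le_total i j with h | h
  · obtain ⟨d, rfl⟩ := Nat.exists_eq_add_of_le h
    obtain ⟨e, rfl⟩ := Nat.exists_eq_add_of_le hj
    have e1 : i + d + e - (i + d) = e := by omega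
    have e2 : i + d + e - i = d + e := by omega
    have e3 : a - i + ((i + d : ℕ) : ℂ) = a + d := by push_cast; ring
    rw [e1, e2, e3, rf_add a d e, add_comm i d, rf_add a d i]
    ring
  · obtain ⟨d, rfl⟩ := Nat.exists_eq_add_of_le h
    obtain ⟨e, rfl⟩ := Nat.exists_eq_add_of_le hi
    have e1 : j + d + e - j = d + e := by omega
    have e2 : j + d + e - (j + d) = e := by omega
    have e3 : a - ((j + d : ℕ) : ℂ) + j = a - d := by push_cast; ring
    rw [e1, e2, e3, rf_add _ d e, add_comm j d, rf_add _ d j]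
    simp only [sub_add_cancel]
    ring

noncomputable def MM (N : ℕ) (α β : ℂ) : Matrix (Fin (N + 1)) (Fin (N + 1)) ℂ :=
  fun i j => rf (α - (i : ℕ) + (j : ℕ)) (N - j) * rf (β + (i : ℕ) - (j : ℕ)) (N - i)

noncomputable def EE (N : ℕ) (α β : ℂ) : Matrix (Fin (N + 1)) (Fin (N + 1)) ℂ :=
  fun i j => rf (α - (i : ℕ) + (j : ℕ)) (N - j) * rf (β + (i : ℕ) - (j : ℕ) + 1) (N - 1 - i)

lemma row_step (N : ℕ) (α β : ℂ) (i : Fin N) (j : Fin (N + 1)) :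
    MM N α β i.castSucc j = (α + β + 1) * EE N α β i.castSucc j
      + (-(α - (i : ℕ) + N)) * MM N α β i.succ j := by
  unfold MM EE
  have hi := i.2
  have hj : (j : ℕ) ≤ N := Nat.lt_succ_iff.mp j.2
  simp only [Fin.val_castSucc, Fin.val_succ]
  have e1 : N - (i : ℕ) = (N - 1 - i) + 1 := by omega
  have e2 : N - ((i : ℕ) + 1) = N - 1 - i := by omega
  have h := rf_shift (α - (i : ℕ) + (j : ℕ)) (N - j)
  rw [e1, e2, rf_succ_left]
  have e3 : α - ((i + 1 : ℕ) : ℂ) + (j : ℕ) = α - (i : ℕ) + (j : ℕ) - 1 := by push_cast; ring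
  have e4 : β + ((i + 1 : ℕ) : ℂ) - (j : ℕ) = β + (i : ℕ) - (j : ℕ) + 1 := by push_cast; ring
  rw [e3, e4]
  have e5 : α - (i : ℕ) + (j : ℕ) + ((N - j : ℕ) : ℂ) = α - (i : ℕ) + N := by
    rw [Nat.cast_sub hj]; ring
  rw [e5] at h
  linear_combination (rf (β + (i : ℕ) - (j : ℕ) + 1) (N - 1 - i)) * h

lemma det_MM_EE (N : ℕ) (α β : ℂ) :
    (MM N α β).det = (α + β + 1) ^ N * (EE N α β).det := by
  let v : Fin (N + 1) → ℂ := Fin.lastCases 1 (fun _ => α + β + 1)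
  have hv : ∏ i, v i = (α + β + 1) ^ N := by
    rw [Fin.prod_univ_castSucc]
    simp [v]
  rw [← hv, ← Matrix.det_mul_column, ← Matrix.det_submatrix_equiv_self Fin.revPerm (MM N α β),
    ← Matrix.det_submatrix_equiv_self Fin.revPerm (Matrix.of _)]
  refine Matrix.det_eq_of_forall_row_eq_smul_add_pred
    (fun i => -(α - ((Fin.rev i : Fin N) : ℕ) + N)) ?_ ?_
  · intro j
    simp [v, MM, EE]
    left
    simp [rf]
  · intro i j
    have := row_step N α β (Fin.rev i) (Fin.rev j)
    simp only [Matrix.submatrix_apply, Fin.revPerm_apply, Matrix.of_apply, Fin.rev_succ,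
      Fin.rev_castSucc, this]
    simp [v]

open Polynomial in
lemma poly_lin (a : ℂ) (k : ℕ) : ∃ P : ℂ[X], P.Monic ∧ P.natDegree = k ∧
    ∀ x, P.eval x = rf (a + x) k := by
  refine ⟨∏ l ∈ Finset.range k, (X + C (a + (l + 1))), ?_, ?_, ?_⟩
  · exact monic_prod_of_monic _ _ fun l _ => monic_X_add_C _
  · rw [natDegree_prod_of_monic _ _ fun l _ => monic_X_add_C _]
    simp only [natDegree_X_add_C]; simp
  · intro x
    rw [eval_prod]
    refine Finset.prod_congr rfl fun l _ => ?_
    simp only [eval_add, eval_X, eval_C]; ring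

open Polynomial in
lemma poly_lin' (a : ℂ) (k : ℕ) : ∃ P : ℂ[X], P.natDegree ≤ k ∧
    ∀ x, P.eval x = rf (a - x) k := by
  refine ⟨∏ l ∈ Finset.range k, (C (a + (l + 1)) - X), ?_, ?_⟩
  · refine (natDegree_prod_le _ _).trans ?_
    refine (Finset.sum_le_card_nsmul _ _ 1 fun l _ => ?_).trans (by simp)
    refine (natDegree_sub_le _ _).trans ?_
    rw [natDegree_C, natDegree_X]; simp
  · intro x
    rw [eval_prod]
    refine Finset.prod_congr rfl fun l _ => ?_
    simp only [eval_sub, eval_X, eval_C]; ring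

noncomputable def cc (N : ℕ) (α : ℂ) (j : ℕ) : ℂ := (-1) ^ (N - j) * (N.choose j : ℂ) * rf α j

lemma sum_eval (N : ℕ) (P : Polynomial ℂ) :
    ∑ j : Fin (N + 1), (-1 : ℂ) ^ (N - (j : ℕ)) * (N.choose j : ℂ) * P.eval ((j : ℕ) : ℂ)
      = (fwdDiff (1 : ℂ))^[N] P.eval 0 := by
  rw [fwdDiff_iter_eq_sum_shift, Fin.sum_univ_eq_sum_range
    (fun j => (-1 : ℂ) ^ (N - j) * (N.choose j : ℂ) * P.eval (j : ℂ))]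
  refine Finset.sum_congr rfl fun j _ => ?_
  simp

lemma col_last (N : ℕ) (α β : ℂ) :
    ∑ j : Fin (N + 1), cc N α j * EE N α β (Fin.last N) j = N.factorial := by
  obtain ⟨P, hm, hd, he⟩ := poly_lin (α - N) N
  have h := sum_eval N P
  have h2 := congrFun (Polynomial.fwdDiff_iter_degree_eq_factorial P) 0
  rw [hd] at h2
  rw [h2, hm.leadingCoeff] at h
  simp only [one_smul] at h
  refine Eq.trans (Finset.sum_congr rfl fun j _ => ?_) (h.trans (by simp))
  rw [he]
  have hs := rf_swap α N N j le_rfl (Nat.lt_succ_iff.mp j.2)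
  have e1 : N - 1 - N = 0 := by omega
  simp only [cc, EE, Fin.val_last, e1]
  simp only [Nat.sub_self] at hs
  have e0 : ∀ x, rf x 0 = 1 := fun x => by simp [rf]
  rw [e0] at hs ⊢
  linear_combination ((-1) ^ (N - (j : ℕ)) * (N.choose j : ℂ)) * hs

lemma col_other (N : ℕ) (α β : ℂ) (i : Fin N) :
    ∑ j : Fin (N + 1), cc N α j * EE N α β i.castSucc j = 0 := by
  obtain ⟨P, hm, hd, he⟩ := poly_lin (α - (i : ℕ)) i
  obtain ⟨Q, hdQ, heQ⟩ := poly_lin' (β + (i : ℕ) + 1) (N - 1 - i)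
  have hi := i.2
  have hdeg : (P * Q).natDegree < N := by
    refine Polynomial.natDegree_mul_le.trans_lt ?_
    omega
  have h := sum_eval N (P * Q)
  rw [Polynomial.fwdDiff_iter_eq_zero_of_degree_lt hdeg] at h
  have : ∀ j : Fin (N + 1), cc N α j * EE N α β i.castSucc j = rf α (N - i) *
      ((-1 : ℂ) ^ (N - (j : ℕ)) * (N.choose j : ℂ) * (P * Q).eval ((j : ℕ) : ℂ)) := by
    intro j
    rw [Polynomial.eval_mul, he, heQ]
    have hs := rf_swap α N i j hi.le (Nat.lt_succ_iff.mp j.2)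
    simp only [cc, EE, Fin.val_castSucc]
    have e4 : β + (i : ℕ) + 1 - (j : ℕ) = β + (i : ℕ) - (j : ℕ) + 1 := by ring
    rw [e4]
    linear_combination ((-1) ^ (N - (j : ℕ)) * (N.choose j : ℂ) *
      rf (β + (i : ℕ) - (j : ℕ) + 1) (N - 1 - i)) * hs
  rw [Finset.sum_congr rfl fun j _ => this j, ← Finset.mul_sum, h]
  simp

lemma det_EE (N : ℕ) (α β : ℂ) :
    (EE (N + 1) α β).det = (N + 1).factorial * (MM N (α + 1) β).det := by
  have h := Matrix.det_updateCol_sum (EE (N + 1) α β) 0 (fun j => cc (N + 1) α j)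
  rw [Matrix.det_succ_column_zero, Fin.sum_univ_castSucc, Finset.sum_eq_zero] at h
  · simp only [Matrix.updateCol_self, smul_eq_mul, col_last] at h
    have hsub : ((EE (N + 1) α β).updateCol 0
        (fun k => ∑ i : Fin (N + 1 + 1), cc (N + 1) α i * EE (N + 1) α β k i)).submatrix
        (Fin.last (N + 1)).succAbove Fin.succ = MM N (α + 1) β := by
      ext i j
      rw [Matrix.submatrix_apply, Matrix.updateCol_ne (Fin.succ_ne_zero j)]
      simp only [Fin.succAbove_last, EE, MM, Fin.val_castSucc, Fin.val_succ]
      congr 2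
      · push_cast; ring
      · omega
      · push_cast; ring
    rw [hsub] at h
    have hc : cc (N + 1) α ((0 : Fin (N + 1 + 1)) : ℕ) = (-1) ^ (N + 1) := by simp [cc, rf]
    rw [hc, zero_add, Fin.val_last, mul_assoc] at h
    exact (mul_left_cancel₀ (pow_ne_zero _ (by norm_num)) h).symm
  · intro i _
    simp only [Matrix.updateCol_self, smul_eq_mul, col_other]
    simp

lemma det_MM (N : ℕ) (α β : ℂ) : (MM N α β).det =
    ∏ k ∈ Finset.range N, ((N - k).factorial : ℂ) * (α + β + (k + 1)) ^ (N - k) := by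
  induction N generalizing α with
  | zero => simp [MM, rf]
  | succ N ih =>
    rw [det_MM_EE, det_EE, ih, Finset.prod_range_succ']
    have : ∀ k ∈ Finset.range N, ((N - k).factorial : ℂ) * (α + 1 + β + (k + 1)) ^ (N - k) =
        ((N + 1 - (k + 1)).factorial : ℂ) * (α + β + ((k + 1 : ℕ) + 1)) ^ (N + 1 - (k + 1)) := by
      intro k _
      rw [Nat.add_sub_add_right]
      congr 2
      push_cast; ring
    rw [Finset.prod_congr rfl this]
    simp
    ring

/-- Closed-form evaluation of the polynomial determinant of the second proof:
`det(∏_{ℓ=1}^{n-j}(α-i+j+ℓ) ∏_{m=1}^{n-i}(β+i-j+m)) = ∏_{k=1}^{n-1}(n-k)! (α+β+k)^{n-k}`. -/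
theorem fhPolyDet_eval (n : ℕ) (hn : 1 ≤ n) (α β : ℂ) :
    Matrix.det (fun i j : Fin n =>
        (∏ ℓ ∈ Finset.range (n - 1 - (j : ℕ)), (α - (i : ℤ) + (j : ℤ) + (ℓ + 1))) *
          ∏ m ∈ Finset.range (n - 1 - (i : ℕ)), (β + (i : ℤ) - (j : ℤ) + (m + 1))) =
      ∏ k ∈ Finset.range (n - 1),
        ((n - (k + 1)).factorial : ℂ) * (α + β + (k + 1)) ^ (n - (k + 1)) := by
  obtain ⟨N, rfl⟩ := Nat.exists_eq_add_of_le' hn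
  have h := det_MM N α β
  simp only [Nat.add_sub_add_right, Nat.add_sub_cancel]
  rw [← h]
  congr 1
end
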